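/- arXiv:math/0609047 — 2 statements merged into one kernel-verified Lean document; each statement's English description precedes it below -/
import Mathlib

section
/- If 𝓗 is an arrangement of topoplanes in ℝⁿ and Y is a flat of 𝓗 of dimension d ≥ 1, then the induced collection 𝓗^Y is an arrangement of topoplanes in Y; that is, every member of 𝓗^Y is a relative topoplane in Y, and for every Z ∈ 𝓗^Y and every nonempty intersection V of a subfamily of 𝓗^Y (the empty intersection being Y itself), either V ⊆ Z or Z ∩ V is a relative topoplane in V. -/
open Set

/-- The `i`-th coordinate hyperplane in `ℝⁿ` (by convention the whole space if `i ≥ n`). -/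
def coordHyp (n i : ℕ) : Set (Fin n → ℝ) := {x | ∀ h : i < n, x ⟨i, h⟩ = 0}

/-- `H` is a topological hyperplane (topoplane) in `ℝⁿ`: some self-homeomorphism of `ℝⁿ`
carries `H` onto the coordinate hyperplane `{x | x₁ = 0}`. -/
def IsTopoplane {n : ℕ} (H : Set (Fin n → ℝ)) : Prop :=
  ∃ e : (Fin n → ℝ) ≃ₜ (Fin n → ℝ), e '' H = coordHyp n 0

/-- `Z` is a relative topoplane in `Y ⊆ ℝⁿ`: `Z ⊆ Y` and some homeomorphism of `Y`
(with the subspace topology) onto some `ℝᵈ`, `d ≥ 1`, carries `Z` onto `{x | x₁ = 0}`. -/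
def IsRelTopoplane {n : ℕ} (Y Z : Set (Fin n → ℝ)) : Prop :=
  Z ⊆ Y ∧ ∃ d : ℕ, 1 ≤ d ∧ ∃ φ : Y ≃ₜ (Fin d → ℝ),
    φ '' {y : Y | (y : Fin n → ℝ) ∈ Z} = coordHyp d 0

/-- `Y` is a flat of the family `𝓗`: a nonempty intersection of a subfamily of `𝓗`
(the empty intersection being all of `ℝⁿ`). -/
def IsFlat {n : ℕ} (𝓗 : Set (Set (Fin n → ℝ))) (Y : Set (Fin n → ℝ)) : Prop :=
  (∃ 𝓢 ⊆ 𝓗, Y = ⋂₀ 𝓢) ∧ Y.Nonempty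

/-- `𝓗` is an arrangement of topoplanes in `ℝⁿ`: a finite set of topoplanes such that for
every `H ∈ 𝓗` and every flat `Y`, either `Y ⊆ H`, or `H ∩ Y = ∅`, or `H ∩ Y` is a
relative topoplane in `Y`. -/
def IsArrangement {n : ℕ} (𝓗 : Set (Set (Fin n → ℝ))) : Prop :=
  𝓗.Finite ∧ (∀ H ∈ 𝓗, IsTopoplane H) ∧
    ∀ H ∈ 𝓗, ∀ Y : Set (Fin n → ℝ), IsFlat 𝓗 Y →
      Y ⊆ H ∨ H ∩ Y = ∅ ∨ IsRelTopoplane Y (H ∩ Y)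

/-- `Y` has dimension `d`: it is homeomorphic, in the subspace topology, to `ℝᵈ`. -/
def HasDim {n : ℕ} (Y : Set (Fin n → ℝ)) (d : ℕ) : Prop :=
  Nonempty (Y ≃ₜ (Fin d → ℝ))

/-- Topoplanes `H₁`, `H₂` cross: some self-homeomorphism of `ℝⁿ` carries them
simultaneously onto the coordinate hyperplanes `{x | x₁ = 0}` and `{x | x₂ = 0}`. -/
def Crosses {n : ℕ} (H₁ H₂ : Set (Fin n → ℝ)) : Prop :=
  ∃ e : (Fin n → ℝ) ≃ₜ (Fin n → ℝ), e '' H₁ = coordHyp n 0 ∧ e '' H₂ = coordHyp n 1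

/-- The pairwise condition for an arrangement to be affine: any two distinct members
are disjoint or cross. -/
def PairwiseAffine {n : ℕ} (𝓗 : Set (Set (Fin n → ℝ))) : Prop :=
  ∀ H₁ ∈ 𝓗, ∀ H₂ ∈ 𝓗, H₁ ≠ H₂ → H₁ ∩ H₂ = ∅ ∨ Crosses H₁ H₂

/-- The collection induced by `𝓗` on a flat `Y`: `𝓗^Y = {Y ∩ H : H ∈ 𝓗, Y ⊄ H, Y ∩ H ≠ ∅}`. -/
def InducedArr {n : ℕ} (𝓗 : Set (Set (Fin n → ℝ))) (Y : Set (Fin n → ℝ)) :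
    Set (Set (Fin n → ℝ)) :=
  {Z | ∃ H ∈ 𝓗, ¬Y ⊆ H ∧ (Y ∩ H).Nonempty ∧ Z = Y ∩ H}

/-- if `𝓗` is an arrangement of topoplanes in `ℝⁿ` and `Y` is a flat of
dimension `d ≥ 1`, then the induced collection `𝓗^Y` is an arrangement of topoplanes in `Y`:
every member of `𝓗^Y` is a relative topoplane in `Y`, and for every `Z ∈ 𝓗^Y` and every
nonempty intersection `V` of a subfamily of `𝓗^Y` (the empty intersection being `Y` itself),
either `V ⊆ Z`, or `Z ∩ V = ∅`, or `Z ∩ V` is a relative topoplane in `V`. -/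
theorem statement0 {n : ℕ} (hn : 1 ≤ n) (𝓗 : Set (Set (Fin n → ℝ)))
    (h𝓗 : IsArrangement 𝓗) (Y : Set (Fin n → ℝ)) (hY : IsFlat 𝓗 Y)
    (d : ℕ) (hd : 1 ≤ d) (hYd : HasDim Y d) :
    (∀ Z ∈ InducedArr 𝓗 Y, IsRelTopoplane Y Z) ∧
    ∀ Z ∈ InducedArr 𝓗 Y, ∀ V : Set (Fin n → ℝ),
      ((∃ 𝓢 ⊆ InducedArr 𝓗 Y, V = Y ∩ ⋂₀ 𝓢) ∧ V.Nonempty) →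
      V ⊆ Z ∨ Z ∩ V = ∅ ∨ IsRelTopoplane V (Z ∩ V) := by
  have inter_isRelTopoplane : ∀ H ∈ 𝓗, ∀ V, V ⊆ Y → IsFlat 𝓗 V →
      V ⊆ Y ∩ H ∨ Y ∩ H ∩ V = ∅ ∨ IsRelTopoplane V (Y ∩ H ∩ V) := by
    intro H hH V hVY hV
    have hV_inter : Y ∩ H ∩ V = H ∩ V := by
      rw [inter_assoc]
      exact inter_eq_right.2 (inter_subset_right.trans hVY)
    rw [hV_inter]
    exact (h𝓗.2.2 H hH V hV).imp_left fun h => subset_inter hVY h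
  constructor
  · rintro Z ⟨H, hH, hYH, hne, rfl⟩
    rcases h𝓗.2.2 H hH Y hY with h | h | h
    · exact absurd h hYH
    · exact absurd (inter_comm Y H ▸ h) hne.ne_empty
    · rwa [inter_comm]
  · rintro Z ⟨H, hH, -, -, rfl⟩ V ⟨⟨𝓢, h𝓢, rfl⟩, hV⟩
    refine inter_isRelTopoplane H hH _ inter_subset_left ⟨?_, hV⟩
    obtain ⟨⟨𝓣, h𝓣, rfl⟩, -⟩ := hY
    refine ⟨𝓣 ∪ {K ∈ 𝓗 | ⋂₀ 𝓣 ∩ K ∈ 𝓢}, union_subset h𝓣 (sep_subset _ _), ?_⟩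
    rw [sInter_union]
    ext x
    refine and_congr_right fun hx => ⟨fun h K hK => (h _ hK.2).2, fun h W hW => ?_⟩
    obtain ⟨K, hK, -, -, rfl⟩ := h𝓢 hW
    exact ⟨hx, h K ⟨hK, hW⟩⟩
end

section
/- Let 𝓗 be an arrangement of topoplanes in ℝⁿ and let Y₀ be a flat of 𝓗. Then the interval [ℝⁿ, Y₀] := {Z : Z is a flat of 𝓗 and Y₀ ⊆ Z}, partially ordered by reverse inclusion, is a geometric lattice with rank function r(Z) = n − dim Z: it is a lattice; r(ℝⁿ) = 0 and r increases by exactly 1 along covering relations; every element is a join of atoms; and r is submodular, i.e., r(Z ∨ W) + r(Z ∧ W) ≤ r(Z) + r(W) for all Z, W in the interval. -/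
open Set

/-- The flat `Y` has rank `r` in the intersection semilattice: `r = n - dim Y`. -/
def FlatRank {n : ℕ} (Y : Set (Fin n → ℝ)) (r : ℕ) : Prop :=
  ∃ d : ℕ, HasDim Y d ∧ r + d = n

/-- In the family `I` of sets ordered by reverse inclusion, `W` covers `Z`:
both belong to `I`, `W ⊊ Z` (so `Z < W` in the order), and no member of `I` lies
strictly between them. -/
def CoversIn {α : Type*} (I : Set (Set α)) (Z W : Set α) : Prop :=
  Z ∈ I ∧ W ∈ I ∧ W ⊂ Z ∧ ¬∃ V ∈ I, W ⊂ V ∧ V ⊂ Z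

section NoRetraction

open MeasureTheory Metric Module
open scoped NNReal

lemma LipschitzWith.bijective_id_add {E : Type*} [NormedAddCommGroup E] [CompleteSpace E]
    {v : E → E} {K : ℝ≥0} (hv : LipschitzWith K v) (hK : K < 1) :
    Function.Bijective fun x => x + v x := by
  have hc : ∀ y, ContractingWith K fun x => y - v x := fun y =>
    ⟨hK, LipschitzWith.of_dist_le_mul fun a b => by
      simpa only [dist_sub_left] using hv.dist_le_mul a b⟩
  refine ⟨fun a b hab => ?_, fun y => ?_⟩
  · refine (hc (a + v a)).fixedPoint_unique' ?_ ?_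
    · simp [Function.IsFixedPt]
    · simp only [Function.IsFixedPt]
      rw [show a + v a = b + v b from hab, add_sub_cancel_right]
  · refine ⟨ContractingWith.fixedPoint _ (hc y), ?_⟩
    have h := (hc y).fixedPoint_isFixedPt
    simp only [Function.IsFixedPt] at h
    rw [sub_eq_iff_eq_add] at h
    exact h.symm

lemma LipschitzOnWith.indicator_closedBall {E F : Type*} [NormedAddCommGroup E] [NormedSpace ℝ E]
    [NormedAddCommGroup F] {u : E → F} {K : ℝ≥0} {r : ℝ}
    (hu : LipschitzOnWith K u (closedBall 0 r)) (h0 : ∀ x, ‖x‖ = r → u x = 0) :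
    LipschitzWith K ((closedBall (0 : E) r).indicator u) := by
  have key : ∀ x y : E, ‖x‖ ≤ r → r < ‖y‖ → ‖u x‖ ≤ K * dist x y := by
    intro x y hx hy
    obtain ⟨t, ht, hz⟩ : ∃ t ∈ Icc (0 : ℝ) 1, ‖AffineMap.lineMap x y t‖ = r := by
      have hcont : ContinuousOn (fun t : ℝ => ‖AffineMap.lineMap x y t‖) (Icc 0 1) :=
        (AffineMap.lineMap_continuous.norm).continuousOn
      exact intermediate_value_Icc zero_le_one hcont (by simpa using ⟨hx, hy.le⟩)
    have h1 := hu.dist_le_mul x (by simpa using hx) (AffineMap.lineMap x y t) (by simp [hz])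
    rw [h0 _ hz, dist_zero_right, dist_left_lineMap, Real.norm_of_nonneg ht.1] at h1
    refine h1.trans (mul_le_mul_of_nonneg_left ?_ K.2)
    exact mul_le_of_le_one_left dist_nonneg ht.2
  refine LipschitzWith.of_dist_le_mul fun x y => ?_
  by_cases hx : ‖x‖ ≤ r <;> by_cases hy : ‖y‖ ≤ r
  · rw [indicator_of_mem (by simpa using hx), indicator_of_mem (by simpa using hy)]
    exact hu.dist_le_mul x (by simpa using hx) y (by simpa using hy)
  · rw [indicator_of_mem (by simpa using hx), indicator_of_notMem (by simpa using hy),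
      dist_zero_right]
    exact key x y hx (not_le.1 hy)
  · rw [indicator_of_notMem (by simpa using hx), indicator_of_mem (by simpa using hy),
      dist_zero_left, dist_comm]
    exact key y x hy (not_le.1 hx)
  · rw [indicator_of_notMem (by simpa using hx), indicator_of_notMem (by simpa using hy), dist_self]
    positivity

lemma ContinuousLinearMap.det_one_add_eq_sum_basis {E : Type*} [NormedAddCommGroup E]
    [NormedSpace ℝ E] [FiniteDimensional ℝ E] (A : E →L[ℝ] E) {s : Finset ℝ}
    (hs : finrank ℝ E < s.card) :
    (1 + A).det = ∑ t ∈ s, (Lagrange.basis s id t).eval 1 * (1 + t • A).det := by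
  classical
  let b := finBasis ℝ E
  let M := LinearMap.toMatrix b b (A : E →ₗ[ℝ] E)
  let p : Polynomial ℝ := Matrix.det
    ((Polynomial.X : Polynomial ℝ) • M.map Polynomial.C + (1 : Matrix _ _ ℝ).map Polynomial.C)
  have hp : ∀ t : ℝ, p.eval t = (1 + t • A).det := by
    intro t
    rw [ContinuousLinearMap.det, ← LinearMap.det_toMatrix b, ← Polynomial.coe_evalRingHom,
      RingHom.map_det]
    congr 1
    ext i j
    simp [M, LinearMap.toMatrix_apply, Matrix.one_apply, add_comm, Finsupp.single_apply, eq_comm]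
    split_ifs <;> simp [mul_comm]
  have hdeg : p.degree < s.card := by
    refine Polynomial.degree_le_natDegree.trans_lt ?_
    have := Polynomial.natDegree_det_X_add_C_le M 1
    rw [Fintype.card_fin] at this
    exact_mod_cast this.trans_lt hs
  have h := congrArg (Polynomial.eval 1)
    (Lagrange.eq_interpolate (v := id) Function.injective_id.injOn hdeg)
  rw [hp, one_smul] at h
  rw [h, Lagrange.interpolate_apply, Polynomial.eval_finsetSum]
  refine Finset.sum_congr rfl fun t _ => ?_
  rw [Polynomial.eval_mul, Polynomial.eval_C, id, hp, mul_comm]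

/-- The closed unit ball does not retract onto the unit sphere by a `C¹` map. -/
theorem not_contDiff_retraction_sphere {E : Type*} [NormedAddCommGroup E] [InnerProductSpace ℝ E]
    [FiniteDimensional ℝ E] {f : E → E} (hf : ContDiff ℝ 1 f)
    (hnorm : ∀ x, ‖f x‖ = 1) (hfix : ∀ x, ‖x‖ = 1 → f x = x) : False := by
  borelize E
  let B : Set E := closedBall 0 1
  let μ : Measure E := Measure.addHaar
  have hBc : IsCompact B := isCompact_closedBall 0 1
  let u : E → E := fun x => f x - x
  have hu : ContDiff ℝ 1 u := hf.sub contDiff_id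
  have hu' : Continuous (fderiv ℝ u) := hu.continuous_fderiv one_ne_zero
  have hud : ∀ x, HasFDerivAt u (fderiv ℝ u x) x := fun x =>
    (hu.differentiable one_ne_zero x).hasFDerivAt
  obtain ⟨K, hK⟩ : ∃ K : ℝ≥0, ∀ x ∈ B, ‖fderiv ℝ u x‖₊ ≤ K := by
    obtain ⟨C, hC⟩ := hBc.exists_bound_of_continuousOn hu'.continuousOn
    exact ⟨C.toNNReal, fun x hx => by
      rw [← NNReal.coe_le_coe, coe_nnnorm]
      exact (hC x hx).trans (Real.le_coe_toNNReal C)⟩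
  have hLip : LipschitzWith K (B.indicator u) :=
    ((convex_closedBall 0 1).lipschitzOnWith_of_nnnorm_fderiv_le
      (fun x _ => (hud x).differentiableAt) hK).indicator_closedBall
      fun x hx => by simp [u, hfix x hx]
  obtain ⟨ε, hε, hdet⟩ : ∃ ε > 0, ∀ A : E →L[ℝ] E, ‖A‖ < ε → 0 < (1 + A).det := by
    have hc : ContinuousAt (fun A : E →L[ℝ] E => (1 + A).det) 0 :=
      (ContinuousLinearMap.continuous_det.comp (continuous_const.add continuous_id)).continuousAt
    have : ∀ᶠ A in nhds (0 : E →L[ℝ] E), 0 < (1 + A).det :=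
      hc.eventually (lt_mem_nhds (by simp [ContinuousLinearMap.det]))
    obtain ⟨ε, hε, h⟩ := Metric.eventually_nhds_iff.1 this
    exact ⟨ε, hε, fun A hA => h (by simpa using hA)⟩
  have hvol : ∀ t : ℝ, 0 < t → t ≤ 1 → t * K < 1 → t * K < ε →
      ∫ x in B, (1 + t • fderiv ℝ u x).det ∂μ = μ.real B := by
    intro t ht ht1' ht1 htε
    have hbij : Function.Bijective fun x => x + t • B.indicator u x := by
      refine LipschitzWith.bijective_id_add (K := t.toNNReal * K)
        (LipschitzWith.of_dist_le_mul fun x y => ?_) ?_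
      swap
      · rwa [← NNReal.coe_lt_coe, NNReal.coe_mul, Real.coe_toNNReal _ ht.le, NNReal.coe_one]
      rw [dist_smul₀, Real.norm_of_nonneg ht.le, NNReal.coe_mul, Real.coe_toNNReal _ ht.le,
        mul_assoc]
      exact mul_le_mul_of_nonneg_left (hLip.dist_le_mul x y) ht.le
    have heq : EqOn (fun x => x + t • B.indicator u x) (fun x => x + t • u x) B := fun x hx => by
      simp [indicator_of_mem hx]
    have hinj : InjOn (fun x => x + t • u x) B := (heq.injOn_iff).1 hbij.1.injOn
    have himg : (fun x => x + t • u x) '' B = B := by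
      refine Subset.antisymm ?_ fun y hy => ?_
      · rintro _ ⟨x, hx, rfl⟩
        have hxn : ‖x‖ ≤ 1 := by simpa [B] using hx
        have : x + t • u x = (1 - t) • x + t • f x := by simp only [u]; module
        simp only [B, mem_closedBall_zero_iff, this]
        calc _ ≤ ‖(1 - t) • x‖ + ‖t • f x‖ := norm_add_le _ _
          _ = (1 - t) * ‖x‖ + t * 1 := by
            rw [norm_smul, norm_smul, hnorm, Real.norm_of_nonneg ht.le,
              Real.norm_of_nonneg (by linarith)]
          _ ≤ 1 := by nlinarith
      · obtain ⟨x, hx⟩ := hbij.2 y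
        by_cases hxB : x ∈ B
        · exact ⟨x, hxB, by simpa [indicator_of_mem hxB] using hx⟩
        · simp only [indicator_of_notMem hxB, smul_zero, add_zero] at hx
          exact absurd (hx ▸ hy) hxB
    have hder : ∀ x ∈ B, HasFDerivWithinAt (fun x => x + t • u x) (1 + t • fderiv ℝ u x) B x :=
      fun x _ => ((hasFDerivAt_id x).add ((hud x).const_smul t)).hasFDerivWithinAt
    have h := integral_image_eq_integral_abs_det_fderiv_smul μ hBc.measurableSet hder hinj
      fun _ => (1 : ℝ)
    rw [himg] at h
    simp only [smul_eq_mul, mul_one, setIntegral_const] at h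
    rw [h]
    refine setIntegral_congr_fun hBc.measurableSet fun x hx => (abs_of_pos (hdet _ ?_)).symm
    rw [norm_smul, Real.norm_of_nonneg ht.le]
    exact (mul_le_mul_of_nonneg_left (by exact_mod_cast hK x hx) ht.le).trans_lt htε
  have hdet0 : ∀ x, (1 + fderiv ℝ u x).det = 0 := by
    intro x
    have hfd : HasFDerivAt f (1 + fderiv ℝ u x) x := by
      have hfu : f = id + u := by ext; simp [u]
      rw [hfu]
      exact (hasFDerivAt_id x).add (hud x)
    by_contra hne
    have hsurj : Function.Surjective (1 + fderiv ℝ u x : E →L[ℝ] E) :=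
      (LinearMap.equivOfDetNeZero _ hne).surjective
    obtain ⟨v, hv⟩ := hsurj (f x)
    have h1 := hfd.norm_sq
    have h2 : HasFDerivAt (fun x => ‖f x‖ ^ 2) (0 : E →L[ℝ] ℝ) x := by
      simpa [hnorm] using hasFDerivAt_const (1 : ℝ) x
    have h3 := DFunLike.congr_fun (h1.unique h2) v
    simp only [smul_apply, ContinuousLinearMap.comp_apply, hv,
      innerSL_apply_apply, real_inner_self_eq_norm_sq, hnorm] at h3
    norm_num at h3
  obtain ⟨δ, hδ, hδ'⟩ : ∃ δ > 0, ∀ t : ℝ, 0 < t → t < δ → t ≤ 1 ∧ t * K < 1 ∧ t * K < ε := by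
    have hK1 : (0 : ℝ) < K + 1 := by positivity
    refine ⟨min 1 (min 1 ε / (K + 1)), by positivity, fun t ht htδ => ?_⟩
    obtain ⟨h1, h2⟩ := lt_min_iff.1 htδ
    obtain ⟨h3, h4⟩ := lt_min_iff.1 ((lt_div_iff₀ hK1).1 h2)
    refine ⟨h1.le, ?_, ?_⟩ <;> linarith
  obtain ⟨s, hs, hcard⟩ := (Ioo_infinite hδ).exists_subset_card_eq (finrank ℝ E + 1)
  have hlt : finrank ℝ E < s.card := by omega
  have hsum : ∑ t ∈ s, (Lagrange.basis s id t).eval (1 : ℝ) = 1 := by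
    simpa [ContinuousLinearMap.det] using
      (ContinuousLinearMap.det_one_add_eq_sum_basis (0 : E →L[ℝ] E) hlt).symm
  have hzero : ∫ x in B, (1 + fderiv ℝ u x).det ∂μ = 0 := by simp [hdet0]
  simp_rw [fun x => ContinuousLinearMap.det_one_add_eq_sum_basis (fderiv ℝ u x) hlt] at hzero
  rw [integral_finsetSum] at hzero
  · have : ∀ t ∈ s, ∫ x in B, (Lagrange.basis s id t).eval 1 * (1 + t • fderiv ℝ u x).det ∂μ
        = (Lagrange.basis s id t).eval 1 * μ.real B := fun t ht => by
      obtain ⟨h0, h1⟩ := hs ht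
      obtain ⟨h2, h3, h4⟩ := hδ' t h0 h1
      rw [integral_const_mul, hvol t h0 h2 h3 h4]
    rw [Finset.sum_congr rfl this, ← Finset.sum_mul, hsum, one_mul] at hzero
    have hpos : 0 < μ B := measure_closedBall_pos μ 0 one_pos
    exact (ENNReal.toReal_pos hpos.ne' hBc.measure_lt_top.ne).ne' hzero
  · intro t _
    refine ContinuousOn.integrableOn_compact hBc (Continuous.continuousOn ?_)
    exact continuous_const.mul (ContinuousLinearMap.continuous_det.comp
      (continuous_const.add (hu'.const_smul t)))

/-- A continuous self-map of a Euclidean space that stays close to the identity has a zero. -/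
theorem exists_eq_zero_of_norm_sub_id_lt {E : Type*} [NormedAddCommGroup E]
    [InnerProductSpace ℝ E] [FiniteDimensional ℝ E] {w : E → E} (hw : Continuous w)
    (hclose : ∀ x, ‖w x - x‖ < 1 / 2) : ∃ x, w x = 0 := by
  by_contra! hne
  let φ : E → ℝ := fun x => max 0 (min 1 (4 * ‖x‖ - 2))
  have hφ : Continuous φ := by fun_prop
  let k : E → E := fun x => w x + φ x • (x - w x)
  have hk : Continuous k := by fun_prop
  have hk1 : ∀ x, 3 / 4 < ‖x‖ → k x = x := fun x hx => by
    have : φ x = 1 := by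
      simp only [φ]
      rw [min_eq_left (by linarith), max_eq_right zero_le_one]
    simp [k, this]
  have hk0 : ∀ x, k x ≠ 0 := by
    intro x h0
    rcases le_or_gt ‖x‖ (1 / 2) with hx | hx
    · have : φ x = 0 := by
        simp only [φ]
        exact max_eq_left ((min_le_right _ _).trans (by linarith))
      exact hne x (by simpa [k, this] using h0)
    · have h1 : (1 - φ x) • (w x - x) = -x := by
        rw [← sub_eq_zero, ← h0]; simp only [k]; module
      have hφ0 : 0 ≤ φ x := le_max_left _ _
      have hφ1 : φ x ≤ 1 := max_le zero_le_one (min_le_left _ _)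
      have h2 := congrArg norm h1
      rw [norm_smul, norm_neg, Real.norm_of_nonneg (by linarith)] at h2
      nlinarith [hclose x, norm_nonneg (w x - x)]
  have hU : IsOpen {x : E | 3 / 4 < ‖x‖} := isOpen_lt continuous_const continuous_norm
  have hS : IsClosed {x : E | 1 ≤ ‖x‖} := isClosed_le continuous_const continuous_norm
  obtain ⟨q, hq, hqk, hqS, -⟩ := hk.exists_contDiff_approx_and_eqOn 1 hk.norm
    (fun x => norm_pos_iff.2 (hk0 x)) hS
    (hU.mem_nhdsSet.2 fun x (hx : 1 ≤ ‖x‖) => show 3 / 4 < ‖x‖ by linarith)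
    (contDiffOn_id.congr hk1)
  have hq0 : ∀ x, q x ≠ 0 := fun x h => by
    have := hqk x
    rw [h, dist_zero_left] at this
    exact this.false
  refine not_contDiff_retraction_sphere (f := fun x => ‖q x‖⁻¹ • q x)
    (((hq.norm ℝ hq0).inv fun x => norm_ne_zero_iff.2 (hq0 x)).smul hq) (fun x => ?_)
    fun x hx => ?_
  · rw [norm_smul, norm_inv, norm_norm, inv_mul_cancel₀ (norm_ne_zero_iff.2 (hq0 x))]
  · have hqx : q x = x := (hqS hx.ge).trans (hk1 x (by rw [hx]; norm_num))
    simp [hqx, hx]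

/-- A Euclidean space is not homeomorphic to one of smaller dimension. -/
theorem Homeomorph.finrank_le {E F : Type*} [NormedAddCommGroup E] [InnerProductSpace ℝ E]
    [FiniteDimensional ℝ E] [NormedAddCommGroup F] [NormedSpace ℝ F] [FiniteDimensional ℝ F]
    (h : E ≃ₜ F) : finrank ℝ E ≤ finrank ℝ F := by
  by_contra! hlt
  obtain ⟨p, hp, hph, -⟩ := h.symm.continuous.exists_contDiff_approx 1
    (ε := fun _ => 1 / 4) continuous_const (by norm_num)
  obtain ⟨c, hc, hcp⟩ := (hp.dense_compl_range_of_finrank_lt_finrank hlt).exists_dist_lt 0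
    (show (0 : ℝ) < 1 / 4 by norm_num)
  obtain ⟨x, hx⟩ := exists_eq_zero_of_norm_sub_id_lt (w := fun x => p (h x) - c)
    ((hp.continuous.comp h.continuous).sub continuous_const) fun x => by
      have h1 := hph (h x)
      rw [h.symm_apply_apply, dist_eq_norm] at h1
      rw [dist_zero_left] at hcp
      calc ‖p (h x) - c - x‖ = ‖(p (h x) - x) - c‖ := by congr 1; abel
        _ ≤ ‖p (h x) - x‖ + ‖c‖ := norm_sub_le _ _
        _ < 1 / 2 := by linarith
  exact hc ⟨h x, sub_eq_zero.1 hx⟩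

theorem Homeomorph.fin_dim_eq {d e : ℕ} (h : (Fin d → ℝ) ≃ₜ (Fin e → ℝ)) : d = e := by
  have key : ∀ {d e : ℕ}, (Fin d → ℝ) ≃ₜ (Fin e → ℝ) → d ≤ e := fun {d e} h => by
    simpa using
      ((EuclideanSpace.equiv (Fin d) ℝ).toHomeomorph.trans h).finrank_le
  exact (key h).antisymm (key h.symm)

end NoRetraction

lemma HasDim.unique {n : ℕ} {Y : Set (Fin n → ℝ)} {d e : ℕ} (hd : HasDim Y d) (he : HasDim Y e) :
    d = e := by
  obtain ⟨f⟩ := hd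
  obtain ⟨g⟩ := he
  exact (f.symm.trans g).fin_dim_eq

lemma HasDim.univ {n : ℕ} : HasDim (Set.univ : Set (Fin n → ℝ)) n :=
  ⟨Homeomorph.Set.univ _⟩

lemma mem_coordHyp_zero {d : ℕ} {x : Fin (d + 1) → ℝ} : x ∈ coordHyp (d + 1) 0 ↔ x 0 = 0 :=
  ⟨fun h => h d.succ_pos, fun h _ => h⟩

lemma hasDim_coordHyp_zero (d : ℕ) : HasDim (coordHyp (d + 1) 0) d :=
  ⟨{ toFun := fun x i => x.1 i.succ
     invFun := fun y => ⟨Fin.cons 0 y, mem_coordHyp_zero.2 (Fin.cons_zero _ _)⟩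
     left_inv := fun x => by
       ext i
       refine Fin.cases ?_ (fun j => ?_) i
       · simpa using (mem_coordHyp_zero.1 x.2).symm
       · simp
     right_inv := fun y => by simp
     continuous_toFun := continuous_pi fun i =>
       (continuous_apply i.succ).comp continuous_subtype_val
     continuous_invFun := by
       refine Continuous.subtype_mk (continuous_pi fun i => ?_) _
       refine Fin.cases ?_ (fun j => ?_) i
       · simpa using continuous_const
       · simpa using continuous_apply j }⟩

lemma IsTopoplane.hasDim {m : ℕ} {H : Set (Fin (m + 1) → ℝ)} (hH : IsTopoplane H) : HasDim H m := by
  obtain ⟨e, he⟩ := hH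
  obtain ⟨g⟩ := hasDim_coordHyp_zero m
  exact ⟨((e.image H).trans (Homeomorph.setCongr he)).trans g⟩

lemma IsTopoplane.nonempty {n : ℕ} {H : Set (Fin n → ℝ)} (hH : IsTopoplane H) : H.Nonempty := by
  obtain ⟨e, he⟩ := hH
  rw [← image_nonempty (f := e), he]
  exact ⟨0, fun _ => rfl⟩

lemma IsRelTopoplane.exists_hasDim {n d : ℕ} {Y Z : Set (Fin n → ℝ)} (h : IsRelTopoplane Y Z)
    (hd : HasDim Y d) : ∃ e, d = e + 1 ∧ HasDim Z e := by
  obtain ⟨hZY, d', hd', φ, hφ⟩ := h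
  obtain rfl : d = d' := hd.unique ⟨φ⟩
  obtain ⟨e, rfl⟩ := Nat.exists_eq_add_of_le' hd'
  obtain ⟨g⟩ := hasDim_coordHyp_zero e
  let ψ : Z ≃ₜ {y : Y | (y : Fin n → ℝ) ∈ Z} :=
    { toFun := fun z => ⟨⟨z.1, hZY z.2⟩, z.2⟩
      invFun := fun y => ⟨y.1.1, y.2⟩
      left_inv := fun _ => rfl
      right_inv := fun _ => rfl
      continuous_toFun := by fun_prop
      continuous_invFun := by fun_prop }
  exact ⟨e, rfl, ⟨((ψ.trans (φ.image _)).trans (Homeomorph.setCongr hφ)).trans g⟩⟩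

section Flats

variable {n : ℕ} {𝓗 : Set (Set (Fin n → ℝ))}

lemma IsFlat.univ : IsFlat 𝓗 Set.univ :=
  ⟨⟨∅, empty_subset _, sInter_empty.symm⟩, univ_nonempty⟩

lemma isFlat_sInter {𝓢 : Set (Set (Fin n → ℝ))} (hS : 𝓢 ⊆ 𝓗) (hne : (⋂₀ 𝓢).Nonempty) :
    IsFlat 𝓗 (⋂₀ 𝓢) :=
  ⟨⟨𝓢, hS, rfl⟩, hne⟩

lemma IsFlat.of_mem {H : Set (Fin n → ℝ)} (hH : H ∈ 𝓗) (hne : H.Nonempty) : IsFlat 𝓗 H :=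
  ⟨⟨{H}, singleton_subset_iff.2 hH, (sInter_singleton H).symm⟩, hne⟩

lemma IsFlat.inter {Y Z : Set (Fin n → ℝ)} (hY : IsFlat 𝓗 Y) (hZ : IsFlat 𝓗 Z)
    (hne : (Y ∩ Z).Nonempty) : IsFlat 𝓗 (Y ∩ Z) := by
  obtain ⟨⟨S, hS, rfl⟩, -⟩ := hY
  obtain ⟨⟨T, hT, rfl⟩, -⟩ := hZ
  exact ⟨⟨S ∪ T, union_subset hS hT, (sInter_union S T).symm⟩, hne⟩

lemma IsFlat.exists_not_subset {Y Z : Set (Fin n → ℝ)} (hY : IsFlat 𝓗 Y) (h : ¬Z ⊆ Y) :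
    ∃ H ∈ 𝓗, Y ⊆ H ∧ ¬Z ⊆ H := by
  obtain ⟨⟨S, hS, rfl⟩, -⟩ := hY
  simp only [subset_sInter_iff, not_forall] at h
  obtain ⟨H, hH, hZ⟩ := h
  exact ⟨H, hS hH, sInter_subset_of_mem hH, hZ⟩

/-- A hyperplane that meets a flat without containing it cuts the dimension down by one. -/
lemma IsArrangement.exists_hasDim_inter (h𝓗 : IsArrangement 𝓗) {H Y : Set (Fin n → ℝ)} {d : ℕ}
    (hH : H ∈ 𝓗) (hY : IsFlat 𝓗 Y) (hne : (H ∩ Y).Nonempty) (hYH : ¬Y ⊆ H) (hd : HasDim Y d) :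
    ∃ e, d = e + 1 ∧ HasDim (H ∩ Y) e := by
  rcases h𝓗.2.2 H hH Y hY with h | h | h
  · exact absurd h hYH
  · exact absurd h hne.ne_empty
  · exact h.exists_hasDim hd

/-- Intersecting with hyperplanes lowers the dimension of a flat at least as much as that of any
flat it contains. -/
lemma IsArrangement.exists_hasDim_inter_sInter (h𝓗 : IsArrangement 𝓗) {M W : Set (Fin n → ℝ)}
    {a b : ℕ} (hM : IsFlat 𝓗 M) (hW : IsFlat 𝓗 W) (hWM : W ⊆ M) (ha : HasDim M a)
    (hb : HasDim W b) {𝓢 : Set (Set (Fin n → ℝ))} (hS : 𝓢 ⊆ 𝓗) (hne : (⋂₀ 𝓢 ∩ W).Nonempty) :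
    ∃ a' b', HasDim (⋂₀ 𝓢 ∩ M) a' ∧ HasDim (⋂₀ 𝓢 ∩ W) b' ∧ b + a' ≤ b' + a := by
  have hfin : 𝓢.Finite := h𝓗.1.subset hS
  induction 𝓢, hfin using Set.Finite.induction_on with
  | empty => exact ⟨a, b, by simpa using ha, by simpa using hb, le_rfl⟩
  | @insert H T _ _ ih =>
    obtain ⟨hH, hT⟩ := insert_subset_iff.1 hS
    rw [sInter_insert, inter_assoc] at hne
    have hneW : (⋂₀ T ∩ W).Nonempty := hne.mono inter_subset_right
    have hsub : ⋂₀ T ∩ W ⊆ ⋂₀ T ∩ M := inter_subset_inter_right _ hWM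
    have hTf : IsFlat 𝓗 (⋂₀ T) := isFlat_sInter hT (hneW.mono inter_subset_left)
    have hMf : IsFlat 𝓗 (⋂₀ T ∩ M) := hTf.inter hM (hneW.mono hsub)
    have hWf : IsFlat 𝓗 (⋂₀ T ∩ W) := hTf.inter hW hneW
    obtain ⟨a', b', ha', hb', hle⟩ := ih hT hneW
    rw [sInter_insert, inter_assoc, inter_assoc]
    by_cases hMH : ⋂₀ T ∩ M ⊆ H
    · rw [inter_eq_right.2 hMH, inter_eq_right.2 (hsub.trans hMH)]
      exact ⟨a', b', ha', hb', hle⟩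
    · obtain ⟨a'', rfl, ha''⟩ := h𝓗.exists_hasDim_inter hH hMf
        (hne.mono (inter_subset_inter_right _ hsub)) hMH ha'
      by_cases hWH : ⋂₀ T ∩ W ⊆ H
      · rw [inter_eq_right.2 hWH]
        exact ⟨a'', b', ha'', hb', by omega⟩
      · obtain ⟨b'', rfl, hb''⟩ := h𝓗.exists_hasDim_inter hH hWf hne hWH hb'
        exact ⟨a'', b'', ha'', hb'', by omega⟩

end Flats

/-- for an arrangement of topoplanes `𝓗` and a flat `Y₀`, the interval
`[ℝⁿ, Y₀] = {Z : Z a flat of 𝓗, Y₀ ⊆ Z}`, ordered by reverse inclusion, is a geometric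
lattice with rank `r(Z) = n - dim Z`: it is a lattice (binary joins and meets exist);
`ℝⁿ` is its minimum and has rank `0`; the rank increases by exactly `1` along covering
relations; every element is a join (least upper bound) of atoms; and the rank is
submodular: `r(Z ∨ W) + r(Z ∧ W) ≤ r(Z) + r(W)`. -/
theorem statement1 {n : ℕ} (hn : 1 ≤ n) (𝓗 : Set (Set (Fin n → ℝ)))
    (h𝓗 : IsArrangement 𝓗) (Y₀ : Set (Fin n → ℝ)) (hY₀ : IsFlat 𝓗 Y₀) :
    ∀ I : Set (Set (Fin n → ℝ)), I = {Z | IsFlat 𝓗 Z ∧ Y₀ ⊆ Z} →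
      -- it is a lattice: binary joins and meets exist (w.r.t. reverse inclusion)
      (∀ Z ∈ I, ∀ W ∈ I,
        (∃ J ∈ I, J ⊆ Z ∧ J ⊆ W ∧ ∀ K ∈ I, K ⊆ Z → K ⊆ W → K ⊆ J) ∧
        (∃ M ∈ I, Z ⊆ M ∧ W ⊆ M ∧ ∀ K ∈ I, Z ⊆ K → W ⊆ K → M ⊆ K)) ∧
      -- `ℝⁿ` is the minimum element and has rank 0
      ((Set.univ : Set (Fin n → ℝ)) ∈ I ∧ FlatRank (Set.univ : Set (Fin n → ℝ)) 0) ∧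
      -- rank increases by exactly 1 along covering relations
      (∀ Z W : Set (Fin n → ℝ), CoversIn I Z W →
        ∀ r s : ℕ, FlatRank Z r → FlatRank W s → s = r + 1) ∧
      -- every element is a join of atoms: `Z` is a least upper bound of the atoms below it
      (∀ Z ∈ I, ∀ K ∈ I,
        (∀ A : Set (Fin n → ℝ), CoversIn I Set.univ A → Z ⊆ A → K ⊆ A) → K ⊆ Z) ∧
      -- submodularity of the rank
      (∀ Z ∈ I, ∀ W ∈ I, ∀ J M : Set (Fin n → ℝ),
        (J ∈ I ∧ J ⊆ Z ∧ J ⊆ W ∧ ∀ K ∈ I, K ⊆ Z → K ⊆ W → K ⊆ J) →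
        (M ∈ I ∧ Z ⊆ M ∧ W ⊆ M ∧ ∀ K ∈ I, Z ⊆ K → W ⊆ K → M ⊆ K) →
        ∀ rZ rW rJ rM : ℕ, FlatRank Z rZ → FlatRank W rW → FlatRank J rJ →
          FlatRank M rM → rJ + rM ≤ rZ + rW) := by
  rintro I rfl
  have hne : ∀ {Z : Set (Fin n → ℝ)}, Y₀ ⊆ Z → Z.Nonempty := fun h => hY₀.2.mono h
  refine ⟨?_, ⟨⟨IsFlat.univ, subset_univ _⟩, n, HasDim.univ, zero_add n⟩, ?_, ?_, ?_⟩
  · rintro Z ⟨hZ, hZ0⟩ W ⟨hW, hW0⟩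
    refine ⟨⟨Z ∩ W, ⟨hZ.inter hW (hne (subset_inter hZ0 hW0)), subset_inter hZ0 hW0⟩,
      inter_subset_left, inter_subset_right, fun K _ => subset_inter⟩, ?_⟩
    have hM0 : Y₀ ⊆ ⋂₀ {H ∈ 𝓗 | Z ⊆ H ∧ W ⊆ H} :=
      subset_sInter fun H hH => hZ0.trans hH.2.1
    refine ⟨_, ⟨isFlat_sInter (fun H hH => hH.1) (hne hM0), hM0⟩,
      subset_sInter fun H hH => hH.2.1, subset_sInter fun H hH => hH.2.2, ?_⟩
    rintro K ⟨hK, -⟩ hZK hWK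
    by_contra hMK
    obtain ⟨H, hH, hKH, hMH⟩ := hK.exists_not_subset hMK
    exact hMH (sInter_subset_of_mem ⟨hH, hZK.trans hKH, hWK.trans hKH⟩)
  · rintro Z W ⟨⟨hZ, hZ0⟩, ⟨hW, hW0⟩, hWZ, hcov⟩ r s ⟨d, hd, hrd⟩ ⟨e, he, hse⟩
    obtain ⟨H, hH, hWH, hZH⟩ := hW.exists_not_subset hWZ.2
    have h0 : Y₀ ⊆ H ∩ Z := subset_inter (hW0.trans hWH) hZ0
    have hHf : IsFlat 𝓗 H := IsFlat.of_mem hH (hne (hW0.trans hWH))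
    have hWHZ : W = H ∩ Z := by
      by_contra hWne
      exact hcov ⟨H ∩ Z, ⟨hHf.inter hZ (hne h0), h0⟩,
        (subset_inter hWH hWZ.1).ssubset_of_ne hWne,
        inter_subset_right.ssubset_of_ne fun h => hZH (inter_eq_right.1 h)⟩
    obtain ⟨e', rfl, he'⟩ := h𝓗.exists_hasDim_inter hH hZ (hne h0) hZH hd
    obtain rfl := he.unique (hWHZ ▸ he')
    omega
  · rintro Z ⟨hZ, hZ0⟩ K - hK
    by_contra hKZ
    obtain ⟨H, hH, hZH, hKH⟩ := hZ.exists_not_subset hKZ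
    obtain ⟨m, rfl⟩ := Nat.exists_eq_add_of_le' hn
    have hHdim : HasDim H m := (h𝓗.2.1 H hH).hasDim
    have hHne : H.Nonempty := (h𝓗.2.1 H hH).nonempty
    have hHf : IsFlat 𝓗 H := IsFlat.of_mem hH hHne
    refine hKH (hK H ⟨⟨IsFlat.univ, subset_univ _⟩, ⟨hHf, hZ0.trans hZH⟩,
      ssubset_univ_iff.2 fun h => ?_, ?_⟩ hZH)
    · exact absurd (hHdim.unique (h ▸ HasDim.univ)) (by omega)
    · rintro ⟨V, ⟨hV, -⟩, hHV, hVuniv⟩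
      obtain ⟨H', hH', hVH', -⟩ := hV.exists_not_subset hVuniv.2
      have hHH' : H ⊂ H' := hHV.trans_subset hVH'
      have hinter : H ∩ H' = H := inter_eq_left.2 hHH'.1
      obtain ⟨e, hme, he⟩ := h𝓗.exists_hasDim_inter hH
        (IsFlat.of_mem hH' (hHne.mono hHH'.1)) (hinter.symm ▸ hHne) hHH'.2 (h𝓗.2.1 H' hH').hasDim
      rw [hinter] at he
      exact absurd (hHdim.unique he) (by omega)
  · rintro Z ⟨hZ, hZ0⟩ W ⟨hW, hW0⟩ J M ⟨-, hJZ, hJW, hJ⟩ ⟨⟨hM, -⟩, hZM, hWM, -⟩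
      rZ rW rJ rM ⟨dZ, hdZ, hZn⟩ ⟨dW, hdW, hWn⟩ ⟨dJ, hdJ, hJn⟩ ⟨dM, hdM, hMn⟩
    have h0 : Y₀ ⊆ Z ∩ W := subset_inter hZ0 hW0
    have hJeq : J = Z ∩ W := (subset_inter hJZ hJW).antisymm
      (hJ _ ⟨hZ.inter hW (hne h0), h0⟩ inter_subset_left inter_subset_right)
    obtain ⟨⟨S, hS, rfl⟩, -⟩ := hZ
    obtain ⟨a, b, ha, hb, hle⟩ :=
      h𝓗.exists_hasDim_inter_sInter hM hW hWM hdM hdW hS (hne h0)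
    rw [inter_eq_left.2 hZM] at ha
    obtain rfl := hdZ.unique ha
    obtain rfl := hdJ.unique (hJeq ▸ hb)
    omega
end
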